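/- arXiv:2106.14477 — 5 statements merged into one kernel-verified Lean document; each statement's English description precedes it below -/
import Mathlib

section
/- Null intersection lemma, part (i) (Lemma 3.1(i)): Assume e ∈ N and that e+V has the Weierstrass surjectivity property. Then the P-saturation of the affine translate e+V meets the nilfibre exactly in the P-orbit of e, i.e. {g·(e+v)·g⁻¹ : g ∈ P, v ∈ V} ∩ N = {g·e·g⁻¹ : g ∈ P}. In particular the only element of e+V that lies in N is e itself (if v ∈ V and e+v ∈ N then v = 0). -/
open Matrix

abbrev Mat (n : ℕ) : Type := Matrix (Fin n) (Fin n) ℂ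

/-- The nilradical `𝔪` of the parabolic: strictly block upper triangular matrices. -/
def mRad (n k : ℕ) (β : Fin n → Fin k) : Set (Mat n) :=
  {x | ∀ i j, β j ≤ β i → x i j = 0}

/-- The parabolic subalgebra `𝔭`: block upper triangular matrices. -/
def pPar (n k : ℕ) (β : Fin n → Fin k) : Set (Mat n) :=
  {x | ∀ i j, β j < β i → x i j = 0}

/-- The parabolic group `P`: invertible block upper triangular matrices. -/
def Pgrp (n k : ℕ) (β : Fin n → Fin k) : Set (Mat n) :=
  {g | IsUnit g ∧ ∀ i j, β j < β i → g i j = 0}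

/-- The derived group `P'`: elements of `P` whose diagonal blocks have determinant `1`. -/
def Pder (n k : ℕ) (β : Fin n → Fin k) : Set (Mat n) :=
  {g | g ∈ Pgrp n k β ∧ ∀ b : Fin k,
    (g.submatrix (fun i : {i : Fin n // β i = b} => (i : Fin n))
      (fun i : {i : Fin n // β i = b} => (i : Fin n))).det = 1}

/-- Index type for the matrix coordinates `x i j` with `β i < β j`, i.e. coordinates on `𝔪`. -/
abbrev CoordIdx (n k : ℕ) (β : Fin n → Fin k) : Type :=
  {p : Fin n × Fin n // β p.1 < β p.2}

/-- Evaluation of a polynomial function on `𝔪` at a matrix `y`. -/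
noncomputable def evalAt (n k : ℕ) (β : Fin n → Fin k) (y : Mat n)
    (f : MvPolynomial (CoordIdx n k β) ℂ) : ℂ :=
  MvPolynomial.eval (fun p => y p.val.1 p.val.2) f

/-- `P'`-invariance of a polynomial function on `𝔪`. -/
def PInvariant (n k : ℕ) (β : Fin n → Fin k)
    (f : MvPolynomial (CoordIdx n k β) ℂ) : Prop :=
  ∀ g ∈ Pder n k β, ∀ y ∈ mRad n k β,
    evalAt n k β (g * y * g⁻¹) f = evalAt n k β y f

/-- The nilfibre `𝒩`: common zeros in `𝔪` of the `P'`-invariant polynomial functions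
homogeneous of positive degree. -/
def Nilfibre (n k : ℕ) (β : Fin n → Fin k) : Set (Mat n) :=
  {y | y ∈ mRad n k β ∧ ∀ d : ℕ, 1 ≤ d →
    ∀ f : MvPolynomial (CoordIdx n k β) ℂ,
      f.IsHomogeneous d → PInvariant n k β f → evalAt n k β y f = 0}

/-- The Weierstrass surjectivity property for the affine translate `e + V`. -/
def WSurj (n k : ℕ) (β : Fin n → Fin k) (e : Mat n) (V : Submodule ℂ (Mat n)) : Prop :=
  ∀ ξ : V →ₗ[ℂ] ℂ, ∃ d : ℕ, 1 ≤ d ∧ ∃ f : MvPolynomial (CoordIdx n k β) ℂ,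
    f.IsHomogeneous d ∧ PInvariant n k β f ∧
      ∀ v : V, evalAt n k β (e + (v : Mat n)) f = ξ v

lemma bt_block_mul {n k : ℕ} {β : Fin n → Fin k} {a c : Mat n}
    (ha : a.BlockTriangular β) (hc : c.BlockTriangular β) (b : Fin k) :
    ((a * c).submatrix (fun i : {i : Fin n // β i = b} => (i : Fin n))
      (fun i : {i : Fin n // β i = b} => (i : Fin n))) =
    (a.submatrix (fun i : {i : Fin n // β i = b} => (i : Fin n))
      (fun i : {i : Fin n // β i = b} => (i : Fin n))) *
    (c.submatrix (fun i : {i : Fin n // β i = b} => (i : Fin n))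
      (fun i : {i : Fin n // β i = b} => (i : Fin n))) := by
  ext ⟨i, hi⟩ ⟨j, hj⟩
  simp only [Matrix.submatrix_apply, Matrix.mul_apply]
  refine (Finset.sum_of_injOn (fun x : {i : Fin n // β i = b} => (x : Fin n))
    Subtype.val_injective.injOn (by simp) ?_ (by simp)).symm
  intro x _ hx
  have hx' : β x ≠ b := by simpa using hx
  rcases lt_or_gt_of_ne hx' with hlt | hlt
  · rw [ha (by rw [hi]; exact hlt), zero_mul]
  · rw [hc (by rw [hj]; exact hlt), mul_zero]

lemma bt_inv {n k : ℕ} {β : Fin n → Fin k} {h : Mat n} (hh : h ∈ Pgrp n k β) :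
    (h⁻¹).BlockTriangular β := by
  haveI := hh.1.invertible
  exact Matrix.blockTriangular_inv_of_blockTriangular hh.2

lemma inv_mem {n k : ℕ} {β : Fin n → Fin k} {h : Mat n} (hh : h ∈ Pgrp n k β) :
    h⁻¹ ∈ Pgrp n k β :=
  ⟨by
    have := hh.1
    rw [Matrix.isUnit_iff_isUnit_det] at this ⊢
    exact Matrix.isUnit_nonsing_inv_det h this, bt_inv hh⟩

lemma conj_mem_der {n k : ℕ} {β : Fin n → Fin k} {h g : Mat n} (hh : h ∈ Pgrp n k β)
    (hg : g ∈ Pder n k β) : h * g * h⁻¹ ∈ Pder n k β := by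
  have hi := inv_mem hh
  have h1 : h.BlockTriangular β := hh.2
  have h2 : g.BlockTriangular β := hg.1.2
  have h3 := bt_inv hh
  refine ⟨⟨(hh.1.mul hg.1.1).mul hi.1, (h1.mul h2).mul h3⟩, fun b => ?_⟩
  rw [bt_block_mul (h1.mul h2) h3, bt_block_mul h1 h2, Matrix.det_mul, Matrix.det_mul, hg.2 b,
    mul_one, ← Matrix.det_mul, ← bt_block_mul h1 h3,
    Matrix.mul_nonsing_inv h ((Matrix.isUnit_iff_isUnit_det _).1 hh.1),
    Matrix.submatrix_one _ Subtype.val_injective, Matrix.det_one]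

lemma conj_mem_rad {n k : ℕ} {β : Fin n → Fin k} {h y : Mat n} (hh : h ∈ Pgrp n k β)
    (hy : y ∈ mRad n k β) : h * y * h⁻¹ ∈ mRad n k β := by
  have h3 := bt_inv hh
  intro i j hij
  simp only [Matrix.mul_apply]
  apply Finset.sum_eq_zero
  intro c _
  by_cases hc : β j < β c
  · rw [h3 hc, mul_zero]
  · rw [Finset.sum_eq_zero, zero_mul]
    intro a _
    by_cases ha : β a < β i
    · rw [hh.2 _ _ ha, zero_mul]
    · rw [hy a c ((not_lt.1 hc).trans (hij.trans (not_lt.1 ha))), mul_zero]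

noncomputable def pullf {n k : ℕ} {β : Fin n → Fin k} (h : Mat n)
    (f : MvPolynomial (CoordIdx n k β) ℂ) : MvPolynomial (CoordIdx n k β) ℂ :=
  MvPolynomial.aeval (fun p : CoordIdx n k β => ∑ q : CoordIdx n k β,
    MvPolynomial.C (h p.val.1 q.val.1 * h⁻¹ q.val.2 p.val.2) * MvPolynomial.X q) f

lemma pullf_hom {n k : ℕ} {β : Fin n → Fin k} (h : Mat n)
    (f : MvPolynomial (CoordIdx n k β) ℂ) {d : ℕ} (hf : f.IsHomogeneous d) :
    (pullf h f).IsHomogeneous d := by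
  have := hf.aeval (fun p : CoordIdx n k β => ∑ q : CoordIdx n k β,
    MvPolynomial.C (h p.val.1 q.val.1 * h⁻¹ q.val.2 p.val.2) * MvPolynomial.X q) (n := 1) ?_
  · simpa [pullf] using this
  · intro p
    apply MvPolynomial.IsHomogeneous.sum
    intro q _
    exact MvPolynomial.isHomogeneous_C_mul_X _ _

lemma pullf_eval {n k : ℕ} {β : Fin n → Fin k} (h : Mat n)
    (f : MvPolynomial (CoordIdx n k β) ℂ) {y : Mat n} (hy : y ∈ mRad n k β) :
    evalAt n k β y (pullf h f) = evalAt n k β (h * y * h⁻¹) f := by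
  unfold evalAt pullf
  change MvPolynomial.eval _ (MvPolynomial.bind₁ _ f) = _
  rw [MvPolynomial.eval, MvPolynomial.eval₂Hom_bind₁]
  congr 2
  funext p
  simp only [MvPolynomial.coe_eval₂Hom, MvPolynomial.eval₂_sum, MvPolynomial.eval₂_mul,
    MvPolynomial.eval₂_C, MvPolynomial.eval₂_X, RingHom.id_apply]
  simp only [Matrix.mul_apply, Finset.sum_mul]
  rw [Finset.sum_comm, ← Finset.sum_product']
  refine Finset.sum_of_injOn (fun x : CoordIdx n k β => (x : Fin n × Fin n))
    Subtype.val_injective.injOn (by simp) ?_ ?_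
  · intro x _ hx
    have hx' : ¬ β x.1 < β x.2 := by
      intro hlt
      exact hx ⟨⟨x, hlt⟩, by simp, rfl⟩
    rw [hy _ _ (not_lt.1 hx')]
    simp
  · intro q _
    ring

lemma nil_stable {n k : ℕ} {β : Fin n → Fin k} {h y : Mat n} (hh : h ∈ Pgrp n k β)
    (hy : y ∈ Nilfibre n k β) : h * y * h⁻¹ ∈ Nilfibre n k β := by
  refine ⟨conj_mem_rad hh hy.1, fun d hd f hf hinv => ?_⟩
  rw [← pullf_eval h f hy.1]
  refine hy.2 d hd _ (pullf_hom h f hf) ?_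
  intro g hg z hz
  rw [pullf_eval h f (conj_mem_rad hg.1 hz), pullf_eval h f hz,
    ← hinv _ (conj_mem_der hh hg) _ (conj_mem_rad hh hz)]
  congr 1
  have hu := (Matrix.isUnit_iff_isUnit_det _).1 hh.1
  rw [Matrix.mul_inv_rev, Matrix.mul_inv_rev, Matrix.nonsing_inv_nonsing_inv h hu]
  simp only [Matrix.mul_assoc, Matrix.nonsing_inv_mul_cancel_left _ _ hu]

/-- Lemma 3.1(i): `P.(e+V) ∩ 𝒩 = P.e`; in particular the only element of `e + V`
lying in `𝒩` is `e` itself. -/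
theorem stmt0 (n k : ℕ) (hn : 0 < n) (hk : 0 < k)
    (β : Fin n → Fin k) (hmono : Monotone β) (hsurj : Function.Surjective β)
    (e : Mat n) (he : e ∈ mRad n k β)
    (V : Submodule ℂ (Mat n)) (hV : (V : Set (Mat n)) ⊆ mRad n k β)
    (heN : e ∈ Nilfibre n k β) (hW : WSurj n k β e V) :
    ({y | ∃ g ∈ Pgrp n k β, ∃ v ∈ V, y = g * (e + v) * g⁻¹} ∩ Nilfibre n k β
      = {y | ∃ g ∈ Pgrp n k β, y = g * e * g⁻¹}) ∧
    (∀ v ∈ V, e + v ∈ Nilfibre n k β → v = 0) := by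
  have key : ∀ v ∈ V, e + v ∈ Nilfibre n k β → v = 0 := by
    intro v hv hN
    by_contra hne
    have hne' : (⟨v, hv⟩ : V) ≠ 0 := fun h => hne (congrArg Subtype.val h)
    apply hne'
    rw [← Module.forall_dual_apply_eq_zero_iff ℂ]
    intro ξ
    obtain ⟨d, hd, f, hf, hinv, hev⟩ := hW ξ
    rw [← hev ⟨v, hv⟩]
    exact hN.2 d hd f hf hinv
  refine ⟨?_, key⟩
  ext y
  constructor
  · rintro ⟨⟨g, hg, v, hv, rfl⟩, hN⟩
    have hu := (Matrix.isUnit_iff_isUnit_det _).1 hg.1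
    have h1 := nil_stable (inv_mem hg) hN
    rw [Matrix.nonsing_inv_nonsing_inv g hu] at h1
    have h2 : g⁻¹ * (g * (e + v) * g⁻¹) * g = e + v := by
      simp only [Matrix.mul_assoc, Matrix.nonsing_inv_mul_cancel_left _ _ hu,
        Matrix.nonsing_inv_mul _ hu, Matrix.mul_one]
    rw [h2] at h1
    exact ⟨g, hg, by rw [key v hv h1, add_zero]⟩
  · rintro ⟨g, hg, rfl⟩
    exact ⟨⟨g, hg, 0, V.zero_mem, by rw [add_zero]⟩, nil_stable hg heN⟩
end

section
/- Null intersection lemma, part (ii) (Lemma 3.1(ii)): Assume e ∈ N and that e+V has the Weierstrass surjectivity property. Then [𝔭, e] ∩ V = {0}; that is, for every matrix x with x_{ij} = 0 whenever β(i) > β(j) (i.e. x ∈ 𝔭), if the commutator x·e − e·x lies in V then x·e − e·x = 0. -/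
open Matrix

theorem aux_mul_deriv (h : ℂ → ℂ) (hc : ContinuousAt h 0) (a : ℂ) :
    HasDerivAt (fun t => a + t * h t) (h 0) 0 := by
  rw [hasDerivAt_iff_tendsto_slope_zero]
  have : Filter.Tendsto h (nhdsWithin 0 {0}ᶜ) (nhds (h 0)) := hc.tendsto.mono_left nhdsWithin_le_nhds
  refine this.congr' ?_
  filter_upwards [self_mem_nhdsWithin] with t ht
  have ht' : t ≠ 0 := ht
  simp [ht']

theorem aux_poly_deriv {σ : Type*} (f : MvPolynomial σ ℂ) (γ₁ γ₂ : ℂ → σ → ℂ) (c : σ → ℂ)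
    (h0 : γ₁ 0 = γ₂ 0)
    (h1 : ∀ s, HasDerivAt (fun t => γ₁ t s) (c s) 0)
    (h2 : ∀ s, HasDerivAt (fun t => γ₂ t s) (c s) 0) :
    ∃ D : ℂ, HasDerivAt (fun t => MvPolynomial.eval (γ₁ t) f) D 0 ∧
      HasDerivAt (fun t => MvPolynomial.eval (γ₂ t) f) D 0 := by
  induction f using MvPolynomial.induction_on with
  | C a => exact ⟨0, by simpa using hasDerivAt_const _ _, by simpa using hasDerivAt_const _ _⟩
  | add p q hp hq =>
    obtain ⟨D, a, b⟩ := hp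
    obtain ⟨E, a', b'⟩ := hq
    refine ⟨D + E, ?_, ?_⟩
    · simp only [map_add]; exact a.fun_add a'
    · simp only [map_add]; exact b.fun_add b'
  | mul_X p s hp =>
    obtain ⟨D, a, b⟩ := hp
    refine ⟨D * γ₁ 0 s + MvPolynomial.eval (γ₁ 0) p * c s, ?_, ?_⟩
    · simp only [map_mul, MvPolynomial.eval_X]; exact a.fun_mul (h1 s)
    · simp only [map_mul, MvPolynomial.eval_X]; rw [h0]; exact b.fun_mul (h2 s)

theorem aux_inv_tri {n k : ℕ} {β : Fin n → Fin k} {g : Mat n} (hg : g ∈ Pgrp n k β) :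
    g⁻¹ ∈ Pgrp n k β := by
  obtain ⟨hu, ht⟩ := hg
  have := hu.invertible
  refine ⟨Matrix.isUnit_nonsing_inv_iff.mpr hu, ?_⟩
  exact fun i j hij => blockTriangular_inv_of_blockTriangular (b := β)
    (fun i j hij => ht i j hij) hij

theorem aux_mul_grp {n k : ℕ} {β : Fin n → Fin k} {g h : Mat n} (hg : g ∈ Pgrp n k β)
    (hh : h ∈ Pgrp n k β) : g * h ∈ Pgrp n k β :=
  ⟨hg.1.mul hh.1, fun _ _ hij => Matrix.BlockTriangular.mul (b := β)
    (fun i j hij => hg.2 i j hij) (fun i j hij => hh.2 i j hij) hij⟩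

theorem aux_conj_rad {n k : ℕ} {β : Fin n → Fin k} {g y : Mat n} (hg : g ∈ Pgrp n k β)
    (hy : y ∈ mRad n k β) : g * y * g⁻¹ ∈ mRad n k β := by
  have hi := aux_inv_tri hg
  intro i j hij
  rw [Matrix.mul_apply]
  refine Finset.sum_eq_zero fun l _ => ?_
  rw [Matrix.mul_apply]
  by_cases h1 : β j < β l
  · rw [hi.2 l j h1, mul_zero]
  · rw [Finset.sum_eq_zero, zero_mul]
    intro m _
    by_cases h2 : β m < β i
    · rw [hg.2 i m h2, zero_mul]
    · rw [hy m l (by grind), mul_zero]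

theorem aux_block_mul {n k : ℕ} {β : Fin n → Fin k} {g h : Mat n} (hg : g ∈ Pgrp n k β)
    (hh : h ∈ Pgrp n k β) (b : Fin k) :
    (g * h).submatrix (fun i : {i : Fin n // β i = b} => (i : Fin n))
      (fun i : {i : Fin n // β i = b} => (i : Fin n)) =
    g.submatrix (fun i : {i : Fin n // β i = b} => (i : Fin n))
      (fun i : {i : Fin n // β i = b} => (i : Fin n)) *
    h.submatrix (fun i : {i : Fin n // β i = b} => (i : Fin n))
      (fun i : {i : Fin n // β i = b} => (i : Fin n)) := by
  ext ⟨i, hi⟩ ⟨j, hj⟩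
  simp only [Matrix.submatrix_apply, Matrix.mul_apply]
  rw [← Finset.sum_subtype (Finset.univ.filter fun l => β l = b) (by simp)
    (fun l => g i l * h l j)]
  symm
  refine Finset.sum_filter_of_ne fun l _ hl => ?_
  by_contra hlb
  rcases lt_or_gt_of_ne hlb with h1 | h1
  · exact hl (by rw [hg.2 i l (by rw [hi]; exact h1), zero_mul])
  · exact hl (by rw [hh.2 l j (by rw [hj]; exact h1), mul_zero])

theorem aux_conj_der {n k : ℕ} {β : Fin n → Fin k} {g h : Mat n} (hg : g ∈ Pgrp n k β)
    (hh : h ∈ Pder n k β) : g * h * g⁻¹ ∈ Pder n k β := by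
  have hi := aux_inv_tri hg
  refine ⟨aux_mul_grp (aux_mul_grp hg hh.1) hi, fun b => ?_⟩
  rw [aux_block_mul (aux_mul_grp hg hh.1) hi, aux_block_mul hg hh.1, Matrix.det_mul,
    Matrix.det_mul, hh.2 b, mul_one, ← Matrix.det_mul, ← aux_block_mul hg hi,
    Matrix.mul_nonsing_inv _ ((Matrix.isUnit_iff_isUnit_det g).mp hg.1),
    Matrix.submatrix_one _ Subtype.val_injective, Matrix.det_one]

noncomputable def auxTw {n k : ℕ} (β : Fin n → Fin k) (g : Mat n)
    (f : MvPolynomial (CoordIdx n k β) ℂ) : MvPolynomial (CoordIdx n k β) ℂ :=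
  MvPolynomial.aeval (fun p : CoordIdx n k β => ∑ q : CoordIdx n k β,
    MvPolynomial.C (g p.val.1 q.val.1 * g⁻¹ q.val.2 p.val.2) * MvPolynomial.X q) f

theorem auxTw_hom {n k d : ℕ} {β : Fin n → Fin k} (g : Mat n)
    {f : MvPolynomial (CoordIdx n k β) ℂ} (hf : f.IsHomogeneous d) :
    (auxTw β g f).IsHomogeneous d := by
  have := hf.aeval (n := 1) (fun p : CoordIdx n k β => ∑ q : CoordIdx n k β,
    MvPolynomial.C (g p.val.1 q.val.1 * g⁻¹ q.val.2 p.val.2) * MvPolynomial.X q) (fun p => by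
      refine MvPolynomial.IsHomogeneous.sum _ _ _ fun q _ => ?_
      exact MvPolynomial.isHomogeneous_C_mul_X _ _)
  rwa [one_mul] at this

theorem auxTw_eval {n k : ℕ} {β : Fin n → Fin k} (g : Mat n)
    (f : MvPolynomial (CoordIdx n k β) ℂ) {y : Mat n} (hy : y ∈ mRad n k β) :
    evalAt n k β y (auxTw β g f) = evalAt n k β (g * y * g⁻¹) f := by
  unfold evalAt auxTw
  rw [MvPolynomial.aeval_def, MvPolynomial.algebraMap_eq, MvPolynomial.eval_eval₂]
  have hC : (MvPolynomial.eval (fun p : CoordIdx n k β => y p.val.1 p.val.2)).comp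
    MvPolynomial.C = RingHom.id ℂ := by ext <;> simp
  rw [hC, MvPolynomial.eval₂_id]
  congr 2
  funext p
  simp only [map_sum, map_mul, MvPolynomial.eval_C, MvPolynomial.eval_X]
  have h1 : (g * y * g⁻¹) p.val.1 p.val.2 = ∑ q : Fin n × Fin n,
      g p.val.1 q.1 * g⁻¹ q.2 p.val.2 * y q.1 q.2 := by
    rw [Matrix.mul_apply, Fintype.sum_prod_type, Finset.sum_comm]
    refine Finset.sum_congr rfl fun l _ => ?_
    rw [Matrix.mul_apply, Finset.sum_mul]
    exact Finset.sum_congr rfl fun m _ => by ring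
  rw [h1, ← Finset.sum_subtype (Finset.univ.filter fun q : Fin n × Fin n => β q.1 < β q.2)
    (by simp) (fun q : Fin n × Fin n => g p.val.1 q.1 * g⁻¹ q.2 p.val.2 * y q.1 q.2)]
  refine Finset.sum_filter_of_ne fun q _ hq => ?_
  by_contra hlt
  exact hq (by rw [hy q.1 q.2 (not_lt.mp hlt), mul_zero])

theorem auxTw_inv {n k : ℕ} {β : Fin n → Fin k} {g : Mat n} (hg : g ∈ Pgrp n k β)
    {f : MvPolynomial (CoordIdx n k β) ℂ} (hf : PInvariant n k β f) :
    PInvariant n k β (auxTw β g f) := by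
  intro h hh y hy
  rw [auxTw_eval g f (aux_conj_rad hh.1 hy), auxTw_eval g f hy,
    ← hf _ (aux_conj_der hg hh) _ (aux_conj_rad hg hy)]
  congr 1
  have hdet := (Matrix.isUnit_iff_isUnit_det g).mp hg.1
  rw [Matrix.mul_inv_rev, Matrix.mul_inv_rev, Matrix.nonsing_inv_nonsing_inv _ hdet]
  simp only [Matrix.mul_assoc, Matrix.nonsing_inv_mul_cancel_left _ _ hdet]

/-- Lemma 3.1(ii): `[𝔭, e] ∩ V = {0}`. -/
theorem stmt1 (n k : ℕ) (hn : 0 < n) (hk : 0 < k)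
    (β : Fin n → Fin k) (hmono : Monotone β) (hsurj : Function.Surjective β)
    (e : Mat n) (he : e ∈ mRad n k β)
    (V : Submodule ℂ (Mat n)) (hV : (V : Set (Mat n)) ⊆ mRad n k β)
    (heN : e ∈ Nilfibre n k β) (hW : WSurj n k β e V) :
    ∀ x ∈ pPar n k β, x * e - e * x ∈ V → x * e - e * x = 0 := by
  intro x hx hxV
  by_contra hne
  set w := x * e - e * x with hw
  obtain ⟨ξ, hξ⟩ : ∃ ξ : V →ₗ[ℂ] ℂ, ξ ⟨w, hxV⟩ ≠ 0 := by
    by_contra hall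
    push Not at hall
    have h0 := (Module.forall_dual_apply_eq_zero_iff ℂ (⟨w, hxV⟩ : V)).mp hall
    exact hne (congrArg Subtype.val h0)
  obtain ⟨d, hd, f, hfh, hfi, hfv⟩ := hW ξ
  apply hξ
  have hcl : Continuous (fun t : ℂ => (1 + t • x : Mat n)) := by fun_prop
  have hinv : ContinuousAt (fun t : ℂ => (1 + t • x : Mat n)⁻¹) 0 := by
    have h1 : ContinuousAt (Inv.inv : Mat n → Mat n) (1 + (0 : ℂ) • x) := by
      apply continuousAt_matrix_inv
      have := NormedRing.inverse_continuousAt (1 : ℂˣ)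
      simpa using this
    exact ContinuousAt.comp (f := fun t : ℂ => (1 + t • x : Mat n)) h1 hcl.continuousAt
  have hdet : ∀ᶠ t : ℂ in nhds 0, (1 + t • x : Mat n).det ≠ 0 := by
    have : Continuous (fun t : ℂ => (1 + t • x : Mat n).det) := hcl.matrix_det
    exact this.continuousAt.eventually_ne (by simp)
  have hprod : ContinuousAt (fun t : ℂ => w * (1 + t • x : Mat n)⁻¹) 0 :=
    continuousAt_const.mul hinv
  let γ₁ : ℂ → CoordIdx n k β → ℂ := fun t p =>
    e p.val.1 p.val.2 + t * (w * (1 + t • x : Mat n)⁻¹) p.val.1 p.val.2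
  let γ₂ : ℂ → CoordIdx n k β → ℂ := fun t p =>
    e p.val.1 p.val.2 + t * w p.val.1 p.val.2
  obtain ⟨D, hD1, hD2⟩ := aux_poly_deriv f γ₁ γ₂ (fun p => w p.val.1 p.val.2)
    (by funext p; simp [γ₁, γ₂])
    (fun p => by
      have hc : ContinuousAt (fun t : ℂ => (w * (1 + t • x : Mat n)⁻¹) p.val.1 p.val.2) 0 :=
        continuousAt_pi.mp (continuousAt_pi.mp hprod p.val.1) p.val.2
      have := aux_mul_deriv _ hc (e p.val.1 p.val.2)
      have hv : (w * (1 + (0 : ℂ) • x : Mat n)⁻¹) p.val.1 p.val.2 = w p.val.1 p.val.2 := by simp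
      rw [hv] at this
      exact this)
    (fun p => aux_mul_deriv _ continuousAt_const (e p.val.1 p.val.2))
  have hz1 : D = 0 := by
    refine hD1.unique ?_
    refine (hasDerivAt_const (0 : ℂ) (0 : ℂ)).congr_of_eventuallyEq ?_
    filter_upwards [hdet] with t ht
    have hu : IsUnit (1 + t • x : Mat n).det := isUnit_iff_ne_zero.mpr ht
    have hg : (1 + t • x : Mat n) ∈ Pgrp n k β := by
      refine ⟨(Matrix.isUnit_iff_isUnit_det _).mpr hu, fun i j hij => ?_⟩
      have hij' : i ≠ j := by rintro rfl; exact lt_irrefl _ hij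
      simp [hx i j hij, hij']
    have h0 := heN.2 d hd _ (auxTw_hom (1 + t • x) hfh) (auxTw_inv hg hfi)
    rw [auxTw_eval _ _ he] at h0
    have hconj : (1 + t • x) * e * (1 + t • x)⁻¹ = e + t • (w * (1 + t • x : Mat n)⁻¹) := by
      have h3 : (1 + t • x) * e = e * (1 + t • x) + t • w := by
        rw [hw]
        simp only [add_mul, mul_add, smul_sub, one_mul, mul_one, smul_mul_assoc, mul_smul_comm]
        abel
      rw [h3, add_mul, Matrix.mul_nonsing_inv_cancel_right _ _ hu, smul_mul_assoc]
    rw [hconj] at h0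
    exact h0
  have hz2 : D = ξ ⟨w, hxV⟩ := by
    refine hD2.unique ?_
    have h4 : (fun t => MvPolynomial.eval (γ₂ t) f) = fun t => t * ξ ⟨w, hxV⟩ := by
      funext t
      have := hfv (t • ⟨w, hxV⟩)
      rw [map_smul, smul_eq_mul] at this
      exact this
    rw [h4]
    simpa using (hasDerivAt_id (0 : ℂ)).mul_const (ξ ⟨w, hxV⟩)
  rw [← hz2, hz1]
end

section
/- Torus-orbit statement behind the second part of Lemma 6.2 (E equals the closure of H·e): Suppose I has the distinctness property. Then for every family c : I → ℂˣ of nonzero complex numbers there exists t = (t_1,…,t_n) with each t_m a nonzero complex number, t_1·t_2·⋯·t_n = 1, and t_i · t_j⁻¹ = c_{(i,j)} for every (i,j) ∈ I. (Interpretation: conjugating e = Σ_{(i,j)∈I} E_{ij} by the diagonal maximal torus H of SL(n,ℂ) realizes every vector of the span E of the matrix units {E_{ij} : (i,j) ∈ I} all of whose coordinates are nonzero, so the closure of H·e is all of E.) -/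
/-- The root `e_i − e_j` of type `A_{n−1}` attached to a pair `p = (i, j)`,
as a vector in `ℚ^n`. -/
def typeARoot (n : ℕ) (p : Fin n × Fin n) : Fin n → ℚ :=
  fun m => (if m = p.1 then 1 else 0) - (if m = p.2 then 1 else 0)

/-- Torus-orbit statement behind Lemma 6.2: under the distinctness property, any prescribed
nonzero values `c_(i,j)` can be realized as `tᵢ · tⱼ⁻¹` by a diagonal torus element
`t = (t₁, …, tₙ)` of determinant `1`; hence `H·e` is dense in `E`. -/
theorem stmt6 (n : ℕ) (I : Finset (Fin n × Fin n))
    (hlt : ∀ p ∈ I, p.1 < p.2)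
    (hfst : ∀ p ∈ I, ∀ q ∈ I, p.1 = q.1 → p = q)
    (hsnd : ∀ p ∈ I, ∀ q ∈ I, p.2 = q.2 → p = q)
    (c : I → ℂˣ) :
    ∃ t : Fin n → ℂˣ, (∏ m : Fin n, t m) = 1 ∧
      ∀ p : I, t (p : Fin n × Fin n).1 * (t (p : Fin n × Fin n).2)⁻¹ = c p := by
  have key : ∀ k : ℕ, ∃ t : Fin n → ℂˣ, ∀ p : I, (p : Fin n × Fin n).2.val < k →
      t (p : Fin n × Fin n).1 * (t (p : Fin n × Fin n).2)⁻¹ = c p := by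
    intro k
    induction k with
    | zero => exact ⟨fun _ => 1, fun p hp => absurd hp (Nat.not_lt_zero _)⟩
    | succ k ih =>
      obtain ⟨t, ht⟩ := ih
      by_cases h : ∃ q : I, (q : Fin n × Fin n).2.val = k
      · obtain ⟨q, hq⟩ := h
        refine ⟨Function.update t (q : Fin n × Fin n).2
          (t (q : Fin n × Fin n).1 * (c q)⁻¹), fun p hp => ?_⟩
        have h1 := hlt p p.2
        have h1' : (p : Fin n × Fin n).1.val < (p : Fin n × Fin n).2.val := h1
        have hne : (p : Fin n × Fin n).1 ≠ (q : Fin n × Fin n).2 := by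
          intro h
          have := congrArg Fin.val h
          omega
        rw [Function.update_of_ne hne]
        by_cases hpq : (p : Fin n × Fin n).2 = (q : Fin n × Fin n).2
        · have : p = q := Subtype.ext (hsnd p p.2 q q.2 hpq)
          subst this
          rw [Function.update_self]
          simp
        · rw [Function.update_of_ne hpq]
          apply ht
          have : (p : Fin n × Fin n).2.val ≠ k := fun h => hpq (Fin.ext (h.trans hq.symm))
          omega
      · refine ⟨t, fun p hp => ht p ?_⟩
        have : (p : Fin n × Fin n).2.val ≠ k := fun h' => h ⟨p, h'⟩
        omega
  obtain ⟨t, ht⟩ := key n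
  rcases Nat.eq_zero_or_pos n with rfl | hn
  · exact ⟨t, by simp, fun p => ht p (Fin.is_lt _)⟩
  obtain ⟨z, hz⟩ := IsAlgClosed.exists_pow_nat_eq (((∏ m : Fin n, t m)⁻¹ : ℂˣ) : ℂ) hn
  have hz0 : z ≠ 0 := by
    rintro rfl
    rw [zero_pow hn.ne'] at hz
    exact Units.ne_zero _ hz.symm
  have hu : (Units.mk0 z hz0) ^ n = (∏ m : Fin n, t m)⁻¹ := by
    ext
    rw [Units.val_pow_eq_pow_val, Units.val_mk0, hz]
  refine ⟨fun m => Units.mk0 z hz0 * t m, ?_, fun p => ?_⟩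
  · rw [Finset.prod_mul_distrib, Finset.prod_const, Finset.card_univ, Fintype.card_fin, hu,
      inv_mul_cancel]
  · rw [← ht p (Fin.is_lt _), mul_inv]
    exact mul_mul_mul_comm _ _ _ _ |>.trans (by rw [mul_inv_cancel, one_mul])
end

section
/- Lemma 6.3, first part (strong linear independence): Suppose I has the distinctness property. Then for any two distinct pairs (i,j), (k,l) ∈ I, the difference of the corresponding roots, (e_i − e_j) − (e_k − e_l), is not a nonzero root; that is, it is not of the form e_a − e_b for any indices a ≠ b in {1,…,n}. -/
/-- Lemma 6.3, first part (strong linear independence): for distinct pairs in `I`, the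
difference of the corresponding roots is not a nonzero root. -/
theorem stmt7 (n : ℕ) (I : Finset (Fin n × Fin n))
    (hlt : ∀ p ∈ I, p.1 < p.2)
    (hfst : ∀ p ∈ I, ∀ q ∈ I, p.1 = q.1 → p = q)
    (hsnd : ∀ p ∈ I, ∀ q ∈ I, p.2 = q.2 → p = q)
    (p q : Fin n × Fin n) (hp : p ∈ I) (hq : q ∈ I) (hpq : p ≠ q) :
    ¬ ∃ a b : Fin n, a ≠ b ∧ typeARoot n p - typeARoot n q = typeARoot n (a, b) := by
  rintro ⟨a, b, hab, h⟩
  have h1 : p.1 ≠ q.1 := fun e => hpq (hfst p hp q hq e)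
  have h2 : p.2 ≠ q.2 := fun e => hpq (hsnd p hp q hq e)
  have h3 := (hlt p hp).ne
  have h4 := (hlt q hq).ne
  have e1 := congrFun h p.1
  have e2 := congrFun h q.2
  simp only [typeARoot, Pi.sub_apply, if_true, if_neg h1, if_neg h3, if_neg h4.symm,
    if_neg h2.symm] at e1 e2
  by_cases c : p.1 = q.2
  · rw [if_pos c] at e1
    split_ifs at e1 <;> norm_num at e1
  · have c' : q.2 ≠ p.1 := fun e => c e.symm
    rw [if_neg c] at e1
    rw [if_neg c'] at e2
    have a1 : p.1 = a := by
      by_contra k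
      rw [if_neg k] at e1
      split_ifs at e1 <;> norm_num at e1
    have a2 : q.2 = a := by
      by_contra k
      rw [if_neg k] at e2
      split_ifs at e2 <;> norm_num at e2
    exact c (a1.trans a2.symm)
end

section
/- Lemma 6.3, second part (conjugating the roots of e into the simple roots): Suppose I has the distinctness property. Then there exists a permutation w of {1,…,n} such that w(j) = w(i) + 1 for every (i,j) ∈ I; equivalently, w maps every root e_i − e_j with (i,j) ∈ I to a simple root e_a − e_{a+1} of type A_{n−1}. -/
theorem stmt8_aux (n : ℕ) (I : Finset (Fin n × Fin n))
    (hlt : ∀ p ∈ I, p.1 < p.2)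
    (hfst : ∀ p ∈ I, ∀ q ∈ I, p.1 = q.1 → p = q)
    (hsnd : ∀ p ∈ I, ∀ q ∈ I, p.2 = q.2 → p = q) (k : ℕ) (hk : k ≤ n) :
    ∃ f : Fin n → ℕ, (∀ x : Fin n, x.val < k → f x < k) ∧
      (∀ x y : Fin n, x.val < k → y.val < k → f x = f y → x = y) ∧
      ∀ p ∈ I, p.2.val < k → f p.2 = f p.1 + 1 := by
  induction k with
  | zero => exact ⟨fun _ => 0, by simp, by simp, by simp⟩
  | succ k ih =>
    obtain ⟨f, h1, h2, h3⟩ := ih (by omega)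
    by_cases h : ∃ q ∈ I, q.2.val = k
    · obtain ⟨q, hq, hqk⟩ := h
      have hqlt : q.1.val < k := by have := hlt q hq; omega
      have hqf := h1 _ hqlt
      refine ⟨fun x => if x.val = k then f q.1 + 1 else if f q.1 < f x then f x + 1 else f x,
        ?_, ?_, ?_⟩
      · intro x hx
        have := h1 x
        dsimp only
        split_ifs <;> omega
      · intro x y hx hy hxy
        have a := h1 x
        have b := h1 y
        have c := h2 x y
        dsimp only at hxy
        by_cases hxk : x.val = k <;> by_cases hyk : y.val = k
        · exact Fin.ext (by omega)
        · rw [if_pos hxk, if_neg hyk] at hxy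
          split_ifs at hxy <;> omega
        · rw [if_neg hxk, if_pos hyk] at hxy
          split_ifs at hxy <;> omega
        · rw [if_neg hxk, if_neg hyk] at hxy
          apply c (by omega) (by omega)
          split_ifs at hxy <;> omega
      · intro p hp hpk
        have hpl : p.1.val < p.2.val := hlt p hp
        dsimp only
        by_cases hpk' : p.2.val = k
        · have : p = q := hsnd p hp q hq (Fin.ext (by omega))
          subst this
          rw [if_pos hpk', if_neg (by omega), if_neg (by omega)]
        · have e := h3 p hp (by omega)
          have ne : f p.1 ≠ f q.1 := by
            intro hh
            have := hfst p hp q hq (h2 _ _ (by omega) hqlt hh)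
            subst this
            exact hpk' hqk
          rw [if_neg hpk', if_neg (show ¬ p.1.val = k by omega)]
          split_ifs <;> omega
    · push Not at h
      refine ⟨fun x => if x.val = k then k else f x, ?_, ?_, ?_⟩
      · intro x hx
        have := h1 x
        dsimp only
        split_ifs <;> omega
      · intro x y hx hy hxy
        have a := h1 x
        have b := h1 y
        have c := h2 x y
        dsimp only at hxy
        split_ifs at hxy
        · exact Fin.ext (by omega)
        · omega
        · omega
        · exact c (by omega) (by omega) hxy
      · intro p hp hpk
        have hpl : p.1.val < p.2.val := hlt p hp
        have := h p hp
        dsimp only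
        rw [if_neg this, if_neg (by omega)]
        exact h3 p hp (by omega)

/-- Lemma 6.3, second part: under the distinctness property there is a permutation `w`
of `{1, …, n}` sending every root `e_i − e_j`, `(i,j) ∈ I`, to a simple root, i.e.
`w(j) = w(i) + 1` for every `(i,j) ∈ I`. -/
theorem stmt8 (n : ℕ) (I : Finset (Fin n × Fin n))
    (hlt : ∀ p ∈ I, p.1 < p.2)
    (hfst : ∀ p ∈ I, ∀ q ∈ I, p.1 = q.1 → p = q)
    (hsnd : ∀ p ∈ I, ∀ q ∈ I, p.2 = q.2 → p = q) :
    ∃ w : Equiv.Perm (Fin n), ∀ p ∈ I, ((w p.2 : Fin n) : ℕ) = ((w p.1 : Fin n) : ℕ) + 1 := by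
  obtain ⟨f, h1, h2, h3⟩ := stmt8_aux n I hlt hfst hsnd n le_rfl
  have hinj : Function.Injective (fun x : Fin n => (⟨f x, h1 x x.isLt⟩ : Fin n)) := by
    intro x y hxy
    exact h2 x y x.isLt y.isLt (Fin.mk.inj_iff.mp hxy)
  refine ⟨Equiv.ofBijective _ (Finite.injective_iff_bijective.mp hinj), ?_⟩
  intro p hp
  simpa using h3 p hp p.2.isLt
end
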